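/- (O(1/ε) iterations suffice for an ε-small duality gap.) For every ε > 0, if the Frank–Wolfe algorithm is run for R iterations with R ≥ 2 and R + 2 ≥ (27/4)·C_f·(1 + δ)/ε, then there exists an iterate index r with 1 ≤ r ≤ R such that φ(w^(r)) ≤ ε. -/

import Mathlib

open scoped RealInnerProductSpace BigOperators

noncomputable section

/-- The standard simplex `D = {w ∈ ℝ^K : wᵢ ≥ 0, Σᵢ wᵢ = 1}`. -/
def simplexD (K : ℕ) : Set (EuclideanSpace ℝ (Fin K)) :=
  {w | (∀ i, 0 ≤ w i) ∧ ∑ i, w i = 1}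

/-- The surrogate duality gap `φ(w) = max_{s ∈ D} ⟨w − s, ∇L(w)⟩`. -/
def dualGap {K : ℕ} (gradL : EuclideanSpace ℝ (Fin K) → EuclideanSpace ℝ (Fin K))
    (w : EuclideanSpace ℝ (Fin K)) : ℝ :=
  sSup ((fun s => ⟪w - s, gradL w⟫) '' simplexD K)

theorem conv_grad {K : ℕ} (L : EuclideanSpace ℝ (Fin K) → ℝ)
    (g x y : EuclideanSpace ℝ (Fin K)) (hg : HasGradientAt L g x)
    (hconv : ConvexOn ℝ Set.univ L) : L x - L y ≤ ⟪x, g⟫ - ⟪y, g⟫ := by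
  have hc : ConvexOn ℝ Set.univ (fun t : ℝ => L (AffineMap.lineMap x y t)) := by
    have := hconv.comp_affineMap (AffineMap.lineMap x y : ℝ →ᵃ[ℝ] _)
    rw [Set.preimage_univ] at this
    exact this
  have hd : HasDerivAt (fun t : ℝ => L (AffineMap.lineMap x y t)) ⟪g, y - x⟫ 0 := by
    have h1 : HasDerivAt (fun t : ℝ => (AffineMap.lineMap x y t : EuclideanSpace ℝ (Fin K)))
        (y - x) 0 := AffineMap.hasDerivAt_lineMap
    have h2 : HasFDerivAt L (InnerProductSpace.toDual ℝ _ g)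
        ((AffineMap.lineMap x y (0:ℝ) : EuclideanSpace ℝ (Fin K))) := by
      simpa using hg.hasFDerivAt
    have h3 := h2.comp_hasDerivAt (0:ℝ) h1
    rw [InnerProductSpace.toDual_apply_apply] at h3
    exact h3
  have := hc.le_slope_of_hasDerivAt (Set.mem_univ 0) (Set.mem_univ 1) one_pos hd
  simp [slope_def_field] at this
  rw [inner_sub_right, real_inner_comm, real_inner_comm x g] at this
  rw [real_inner_comm, real_inner_comm g y] 
  linarith [real_inner_comm g x, real_inner_comm g y]

theorem inner_bdd {K : ℕ} (g : EuclideanSpace ℝ (Fin K)) :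
    BddBelow ((fun t => ⟪t, g⟫) '' simplexD K) := by
  refine ⟨-‖g‖, ?_⟩
  rintro _ ⟨t, ht, rfl⟩
  have h : ∀ i, t i * (-‖g‖) ≤ t i * g i := fun i => by
    have h1 : |g i| ≤ ‖g‖ := by simpa using PiLp.norm_apply_le g i
    exact mul_le_mul_of_nonneg_left (by linarith [neg_abs_le (g i)]) (ht.1 i)
  have h2 := Finset.sum_le_sum (fun i (_ : i ∈ Finset.univ) => h i)
  rw [← Finset.sum_mul, ht.2] at h2
  simp only [PiLp.inner_apply, RCLike.inner_apply, conj_trivial]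
  simp only [mul_comm (g _)]
  linarith

theorem simplex_step {K : ℕ} (w s : EuclideanSpace ℝ (Fin K)) (hw : w ∈ simplexD K)
    (hs : s ∈ simplexD K) (γ : ℝ) (h0 : 0 ≤ γ) (h1 : γ ≤ 1) :
    w + γ • (s - w) ∈ simplexD K := by
  constructor
  · intro i
    have := mul_nonneg h0 (hs.1 i)
    have := mul_nonneg (sub_nonneg.2 h1) (hw.1 i)
    simp
    linarith
  · simp [Finset.sum_add_distrib, ← Finset.mul_sum, hw.2, hs.2]

theorem fw_real (h G : ℕ → ℝ) (E ε : ℝ) (R : ℕ) (hR : 2 ≤ R) (hε : 0 < ε)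
    (hE : 27 / 4 * E = ε * ((R : ℝ) + 2))
    (h0 : ∀ r, 0 ≤ h r) (hG : ∀ r, h r ≤ G r)
    (hs : ∀ r : ℕ, h (r + 1) ≤ h r - (2 / ((r : ℝ) + 2)) * G r + 2 * E / ((r : ℝ) + 2) ^ 2)
    (hc : ∀ r, 1 ≤ r → r ≤ R → ε < G r) : False := by
  have hEp : 0 < E := by
    have : 0 < ε * ((R : ℝ) + 2) := by positivity
    linarith
  have hp : ∀ r : ℕ, h (r + 1) ≤ 2 * E / ((r : ℝ) + 3) := by
    intro r
    induction r with
    | zero =>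
      have h1 := hs 0
      have h2 := hG 0
      norm_num at h1 ⊢
      linarith
    | succ r ih =>
      have h1 := hs (r + 1)
      have h2 := hG (r + 1)
      push_cast at h1 ⊢
      have hr : (0:ℝ) ≤ r := Nat.cast_nonneg r
      have e1 : (r:ℝ) + 1 + 2 = r + 3 := by ring
      rw [e1] at h1
      have h3 : 2 / ((r:ℝ) + 3) * h (r + 1) ≤ 2 / ((r:ℝ) + 3) * G (r + 1) :=
        mul_le_mul_of_nonneg_left h2 (by positivity)
      have h4 : (1 - 2 / ((r:ℝ) + 3)) * h (r + 1) ≤ (1 - 2 / ((r:ℝ) + 3)) * (2 * E / ((r : ℝ) + 3)) := by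
        refine mul_le_mul_of_nonneg_left ih ?_
        rw [sub_nonneg, div_le_one (by positivity)]; linarith
      have h5 : (1 - 2 / ((r:ℝ) + 3)) * (2 * E / ((r : ℝ) + 3)) + 2 * E / ((r : ℝ) + 3) ^ 2
          ≤ 2 * E / ((r:ℝ) + 1 + 3) := by
        have : 2 * E / ((r:ℝ) + 1 + 3) - ((1 - 2 / ((r:ℝ) + 3)) * (2 * E / ((r : ℝ) + 3)) + 2 * E / ((r : ℝ) + 3) ^ 2) = 2 * E / (((r:ℝ) + 1 + 3) * (r + 3) ^ 2) := by
          field_simp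
          ring
        have : 0 ≤ 2 * E / (((r:ℝ) + 1 + 3) * (r + 3) ^ 2) := by positivity
        linarith
      linarith
  obtain ⟨k, n, hk1, hk2, hn⟩ : ∃ k n : ℕ, 2 * (R + 2) ≤ 3 * (k + 3) ∧ k + n = R ∧ R + 2 ≤ 3 * n :=
    ⟨R - (R + 4) / 3, (R + 4) / 3, by omega, by omega, by omega⟩
  set D : ℝ := (R : ℝ) + 2 with hD
  have hDp : 0 < D := by positivity
  have hεE : ε = 27 / 4 * E / D := by field_simp; linarith
  have hm : ∀ m : ℕ, m ≤ n → h (k + 1 + m) ≤ h (k + 1) - m * (21 / 2 * E / D ^ 2) := by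
    intro m
    induction m with
    | zero => intro _; simp
    | succ m ih =>
      intro hmn
      have i1 := ih (by omega)
      have i2 := hs (k + 1 + m)
      have i3 := hc (k + 1 + m) (by omega) (by omega)
      set j : ℝ := ((k + 1 + m : ℕ) : ℝ) + 2 with hj
      have hj0 : 0 < j := by positivity
      have hjD : j ≤ D := by
        have : ((k + 1 + m : ℕ) : ℝ) ≤ R := by exact_mod_cast (by omega)
        linarith
      have hjD2 : 2 * D ≤ 3 * j := by
        have : ((2 * (R + 2) : ℕ) : ℝ) ≤ ((3 * (k + 1 + m + 2) : ℕ) : ℝ) := by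
          exact_mod_cast (by omega)
        rw [hj, hD]; push_cast at this ⊢; linarith
      have i4 : 2 / j * ε ≤ 2 / j * G (k + 1 + m) :=
        mul_le_mul_of_nonneg_left i3.le (by positivity)
      have i5 : 2 * E / j ^ 2 - 2 / j * ε ≤ - (21 / 2 * E / D ^ 2) := by
        have a1 : 1 / j ≤ 3 / 2 / D := by
          rw [div_le_div_iff₀ hj0 hDp]; linarith
        have a2 : 1 / D ≤ 1 / j := one_div_le_one_div_of_le hj0 hjD
        have a3 : 0 ≤ 1 / D := by positivity
        have b1 : 2 * E / j ^ 2 - 2 / j * ε = 2 * E * (1 / j) * (1 / j - 27 / 4 * (1 / D)) := by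
          rw [hεE]; field_simp
        have b2 : 21 / 2 * E / D ^ 2 = 2 * E * (1 / D) * (21 / 4 * (1 / D)) := by
          field_simp; ring
        have a1' : 1 / j ≤ 3 / 2 * (1 / D) := by convert a1 using 1; ring
        rw [b1, b2]
        generalize 1 / j = u at *
        generalize 1 / D = v at *
        have c1 : u * (u - 27 / 4 * v) ≤ u * (- (21 / 4 * v)) :=
          mul_le_mul_of_nonneg_left (by linarith) (by linarith)
        have c2 : v * (21 / 4 * v) ≤ u * (21 / 4 * v) :=
          mul_le_mul_of_nonneg_right a2 (by linarith)
        have c3 : 2 * E * (u * (u - 27 / 4 * v)) ≤ 2 * E * (- (v * (21 / 4 * v))) :=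
          mul_le_mul_of_nonneg_left (by linarith) (by linarith)
        linarith
      rw [← add_assoc]
      push_cast
      linarith
  have f1 := hm n le_rfl
  have f2 := hp k
  have f3 := h0 (k + 1 + n)
  have g1 : 2 * E / ((k:ℝ) + 3) ≤ 3 * E / D := by
    have : ((2 * (R + 2) : ℕ) : ℝ) ≤ ((3 * (k + 3) : ℕ) : ℝ) := by exact_mod_cast hk1
    push_cast at this
    rw [div_le_div_iff₀ (by positivity) hDp]
    have := mul_le_mul_of_nonneg_left this hEp.le
    rw [hD]; linarith
  have g2 : 7 / 2 * E / D ≤ n * (21 / 2 * E / D ^ 2) := by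
    have : ((R + 2 : ℕ) : ℝ) ≤ ((3 * n : ℕ) : ℝ) := by exact_mod_cast hn
    push_cast at this
    have e : 7 / 2 * E / D = (D / 3) * (21 / 2 * E / D ^ 2) := by field_simp; ring
    rw [e]
    exact mul_le_mul_of_nonneg_right (by linarith) (by positivity)
  have g3 : 7 / 2 * E / D - 3 * E / D = 1 / 2 * E / D := by ring
  have g4 : 0 < 1 / 2 * E / D := by positivity
  linarith

theorem stmt7 {K : ℕ} (hK : 1 ≤ K)
    (L : EuclideanSpace ℝ (Fin K) → ℝ)
    (gradL : EuclideanSpace ℝ (Fin K) → EuclideanSpace ℝ (Fin K))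
    (hgrad : ∀ x, HasGradientAt L (gradL x) x)
    (hconv : ConvexOn ℝ Set.univ L)
    (Cf : ℝ) (hCf : 0 ≤ Cf)
    (hcurv : ∀ w ∈ simplexD K, ∀ s ∈ simplexD K, ∀ γ ∈ Set.Icc (0:ℝ) 1,
      L (w + γ • (s - w)) ≤ L w + γ * ⟪s - w, gradL w⟫ + γ ^ 2 / 2 * Cf)
    (wstar : EuclideanSpace ℝ (Fin K)) (hwstar : wstar ∈ simplexD K)
    (hmin : ∀ v ∈ simplexD K, L wstar ≤ L v)
    (δ : ℝ) (hδ : 0 ≤ δ)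
    (w s : ℕ → EuclideanSpace ℝ (Fin K))
    (hw0 : w 0 ∈ simplexD K)
    (hsmem : ∀ r : ℕ, s r ∈ simplexD K)
    (hstep : ∀ r : ℕ, w (r + 1) = w r + (2 / ((r : ℝ) + 2)) • (s r - w r))
    (happrox : ∀ r : ℕ, ⟪s r, gradL (w r)⟫ ≤
      sInf ((fun t => ⟪t, gradL (w r)⟫) '' simplexD K) + 1 / 2 * δ * (2 / ((r : ℝ) + 2)) * Cf)
    (ε : ℝ) (hε : 0 < ε) (R : ℕ) (hR : 2 ≤ R)
    (hRε : 27 / 4 * Cf * (1 + δ) / ε ≤ (R : ℝ) + 2) :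
    ∃ r : ℕ, 1 ≤ r ∧ r ≤ R ∧ dualGap gradL (w r) ≤ ε := by
  by_contra hcon
  push Not at hcon
  have hγ0 : ∀ r : ℕ, (0:ℝ) ≤ 2 / ((r : ℝ) + 2) := fun r => by positivity
  have hγ1 : ∀ r : ℕ, 2 / ((r : ℝ) + 2) ≤ 1 := fun r => by
    rw [div_le_one (by positivity)]
    have : (0:ℝ) ≤ r := Nat.cast_nonneg r
    linarith
  have hw : ∀ r, w r ∈ simplexD K := by
    intro r
    induction r with
    | zero => exact hw0
    | succ r ih =>
      rw [hstep]
      exact simplex_step _ _ ih (hsmem r) _ (hγ0 r) (hγ1 r)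
  have hinf : ∀ r, ∀ t ∈ simplexD K,
      sInf ((fun t => ⟪t, gradL (w r)⟫) '' simplexD K) ≤ ⟪t, gradL (w r)⟫ :=
    fun r t ht => csInf_le (inner_bdd _) ⟨t, ht, rfl⟩
  have hEA : Cf * (1 + δ) ≤ 4 / 27 * (ε * ((R : ℝ) + 2)) := by
    rw [div_le_iff₀ hε] at hRε
    linarith
  refine fw_real (fun r => L (w r) - L wstar)
    (fun r => ⟪w r, gradL (w r)⟫ - sInf ((fun t => ⟪t, gradL (w r)⟫) '' simplexD K))
    (4 / 27 * (ε * ((R : ℝ) + 2))) ε R hR hε (by ring) ?_ ?_ ?_ ?_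
  · intro r
    exact sub_nonneg.2 (hmin _ (hw r))
  · intro r
    have h1 := conv_grad L _ (w r) wstar (hgrad _) hconv
    have h2 := hinf r wstar hwstar
    linarith
  · intro r
    have h1 := hcurv (w r) (hw r) (s r) (hsmem r) _ ⟨hγ0 r, hγ1 r⟩
    rw [← hstep, inner_sub_left] at h1
    have h2 := mul_le_mul_of_nonneg_left (happrox r) (hγ0 r)
    have h3 : 2 * (4 / 27 * (ε * ((R : ℝ) + 2))) / ((r:ℝ) + 2) ^ 2
        = (2 / ((r:ℝ) + 2)) ^ 2 / 2 * (4 / 27 * (ε * ((R : ℝ) + 2))) := by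
      field_simp
      try ring
    have h4 := mul_le_mul_of_nonneg_left hEA
      (by positivity : (0:ℝ) ≤ (2 / ((r:ℝ) + 2)) ^ 2 / 2)
    rw [h3]
    linarith
  · intro r h1 h2
    refine lt_of_lt_of_le (hcon r h1 h2) ?_
    refine csSup_le ⟨_, _, hwstar, rfl⟩ ?_
    rintro _ ⟨t, ht, rfl⟩
    have := hinf r t ht
    simp only [inner_sub_left]
    linarith
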